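/- Let a ∈ (-1,1), let p be smooth and L_a-harmonic on ℝ^{n+1} (i.e. div(|y|^a∇p)=0 weakly), and define H(r) = r^{-(n+a)} ∫_{∂B_r} |y|^a p² dσ and E(r) = r^{-(n+a-1)} ∫_{B_r} |y|^a |∇p|² dX and N(r) = E(r)/H(r). If N(r) = k is constant in r on (0,∞) and H(r) > 0 for all r > 0, then p is homogeneous of degree k: p(λX) = λ^k p(X) for all λ > 0 and X ∈ ℝ^{n+1}. -/

import Mathlib

open MeasureTheory Metric Set
open scoped RealInnerProductSpace

noncomputable section

/-- Surface measure on the unit sphere of `ℝ^{n+1}`, obtained from Lebesgue measure. -/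
def sphereMeasure (n : ℕ) :
    Measure (Metric.sphere (0 : EuclideanSpace ℝ (Fin (n + 1))) 1) :=
  (volume : Measure (EuclideanSpace ℝ (Fin (n + 1)))).toSphere

/-- Surface integral of `f` over the sphere `∂B_r(X₀)` (with the Jacobian factor `r^n`). -/
def sphInt (n : ℕ) (f : EuclideanSpace ℝ (Fin (n + 1)) → ℝ)
    (X₀ : EuclideanSpace ℝ (Fin (n + 1))) (r : ℝ) : ℝ :=
  r ^ n * ∫ ω, f (X₀ + r • (ω : EuclideanSpace ℝ (Fin (n + 1)))) ∂(sphereMeasure n)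

/-- The degenerate weight `|y|^a` of the operator `L_a`, where `y` is the last coordinate. -/
def weight (n : ℕ) (a : ℝ) (X : EuclideanSpace ℝ (Fin (n + 1))) : ℝ := |X (Fin.last n)| ^ a

/-- The surface measure of the unit sphere weighted by `|y|^a`. -/
def weightedSphereMeasure (n : ℕ) (a : ℝ) :
    Measure (Metric.sphere (0 : EuclideanSpace ℝ (Fin (n + 1))) 1) :=
  (sphereMeasure n).withDensity fun ω => ENNReal.ofReal (weight n a ω)

lemma weight_nonneg (n : ℕ) (a : ℝ) (X : EuclideanSpace ℝ (Fin (n + 1))) : 0 ≤ weight n a X :=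
  Real.rpow_nonneg (abs_nonneg _) _

lemma weight_smul (n : ℕ) (a : ℝ) {r : ℝ} (hr : 0 < r) (X : EuclideanSpace ℝ (Fin (n + 1))) :
    weight n a (r • X) = r ^ a * weight n a X := by
  simp only [weight, PiLp.smul_apply, smul_eq_mul, abs_mul, abs_of_pos hr]
  exact Real.mul_rpow hr.le (abs_nonneg _)

lemma measurable_weight (n : ℕ) (a : ℝ) : Measurable (weight n a) := by
  unfold weight
  fun_prop

lemma integrableOn_abs_rpow {a : ℝ} (ha : -1 < a) (R : ℝ) :
    IntegrableOn (fun x : ℝ => |x| ^ a) (Icc (-R) R) := by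
  rcases lt_or_ge R 0 with hR | hR
  · rw [Icc_eq_empty (by linarith)]; exact integrableOn_empty
  have h : IntervalIntegrable (fun x : ℝ => |x| ^ a) volume (-R) R := by
    refine intervalIntegrable_of_even (a := -R) (b := R) (by simp) (fun x hx => ?_)
    refine (intervalIntegral.intervalIntegrable_rpow' ha).congr (fun t ht => ?_)
    rw [uIoc_of_le hx.le] at ht
    simp [abs_of_pos ht.1]
  rw [integrableOn_Icc_iff_integrableOn_Ioc (by finiteness)]
  exact (intervalIntegrable_iff_integrableOn_Ioc_of_le (by linarith)).1 h

lemma integrableOn_weight {n : ℕ} {a : ℝ} (ha : -1 < a) (R : ℝ) :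
    IntegrableOn (weight n a) (Metric.ball 0 R) := by
  classical
  let f : Fin (n + 1) → ℝ → ℝ := fun i =>
    (Icc (-R) R).indicator (fun x => if i = Fin.last n then |x| ^ a else 1)
  have hf : ∀ i, Integrable (f i) := by
    intro i
    rw [integrable_indicator_iff measurableSet_Icc]
    by_cases hi : i = Fin.last n
    · simpa [hi] using integrableOn_abs_rpow ha R
    · simp [hi]
  have hprod : Integrable (fun x : Fin (n + 1) → ℝ => ∏ i, f i (x i)) := Integrable.fintype_prod hf
  have hE := (PiLp.volume_preserving_ofLp (Fin (n + 1))).integrable_comp_of_integrable hprod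
  rw [← integrable_indicator_iff Metric.isOpen_ball.measurableSet]
  refine hE.mono
    ((measurable_weight n a).indicator Metric.isOpen_ball.measurableSet).aestronglyMeasurable
    (Filter.Eventually.of_forall fun X => ?_)
  by_cases hX : X ∈ Metric.ball (0 : EuclideanSpace ℝ (Fin (n + 1))) R
  · have hmem : ∀ i, X i ∈ Icc (-R) R := by
      intro i
      have h1 := PiLp.norm_apply_le X i
      have h2 : ‖X‖ < R := by simpa using hX
      rw [Real.norm_eq_abs] at h1
      exact abs_le.1 (by linarith)
    have hval : ∏ i, f i (X i) = weight n a X := by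
      simp only [f, indicator_of_mem (hmem _)]
      simp [weight]
    simp [indicator_of_mem hX, hval]
  · rw [indicator_of_notMem hX, norm_zero]
    exact norm_nonneg _

lemma integrable_polar {n : ℕ} {f : EuclideanSpace ℝ (Fin (n + 1)) → ℝ} (hf : Integrable f) :
    Integrable (fun z : Metric.sphere (0 : EuclideanSpace ℝ (Fin (n + 1))) 1 × Ioi (0 : ℝ) =>
      f ((z.2 : ℝ) • (z.1 : EuclideanSpace ℝ (Fin (n + 1)))))
      ((sphereMeasure n).prod (Measure.volumeIoiPow n)) := by
  have hmp := (volume : Measure (EuclideanSpace ℝ (Fin (n + 1)))).measurePreserving_homeomorphUnitSphereProd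
  rw [finrank_euclideanSpace_fin, Nat.add_sub_cancel] at hmp
  rw [sphereMeasure, ← hmp.integrable_comp_emb (Homeomorph.measurableEmbedding _)]
  have h := hf.integrableOn (s := ({0}ᶜ : Set (EuclideanSpace ℝ (Fin (n + 1)))))
  rw [integrableOn_iff_comap_subtypeVal (by measurability)] at h
  refine h.congr (Filter.Eventually.of_forall fun x => ?_)
  have hx : ‖(x : EuclideanSpace ℝ (Fin (n + 1)))‖ ≠ 0 := norm_ne_zero_iff.2 x.2
  simp [smul_smul, mul_inv_cancel₀ hx]

lemma integral_polar {n : ℕ} {f : EuclideanSpace ℝ (Fin (n + 1)) → ℝ} (hf : Integrable f) :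
    ∫ X, f X = ∫ r in Ioi (0 : ℝ), r ^ n *
      ∫ ω : Metric.sphere (0 : EuclideanSpace ℝ (Fin (n + 1))) 1,
        f (r • (ω : EuclideanSpace ℝ (Fin (n + 1)))) ∂(sphereMeasure n) := by
  have hmp := (volume : Measure (EuclideanSpace ℝ (Fin (n + 1)))).measurePreserving_homeomorphUnitSphereProd
  rw [finrank_euclideanSpace_fin, Nat.add_sub_cancel] at hmp
  have : SFinite (sphereMeasure n) := by unfold sphereMeasure; infer_instance
  calc
    ∫ X, f X = ∫ x : ({(0)}ᶜ : Set (EuclideanSpace ℝ (Fin (n + 1)))), f x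
        ∂((volume : Measure (EuclideanSpace ℝ (Fin (n + 1)))).comap (↑)) := by
      rw [integral_subtype_comap (measurableSet_singleton _).compl f, restrict_compl_singleton]
    _ = ∫ z : Metric.sphere (0 : EuclideanSpace ℝ (Fin (n + 1))) 1 × Ioi (0 : ℝ),
          f ((z.2 : ℝ) • (z.1 : EuclideanSpace ℝ (Fin (n + 1))))
          ∂((sphereMeasure n).prod (Measure.volumeIoiPow n)) := by
      rw [sphereMeasure, ← hmp.integral_comp (Homeomorph.measurableEmbedding _)]
      refine integral_congr_ae (Filter.Eventually.of_forall fun x => ?_)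
      have hx : ‖(x : EuclideanSpace ℝ (Fin (n + 1)))‖ ≠ 0 := norm_ne_zero_iff.2 x.2
      simp [smul_smul, mul_inv_cancel₀ hx]
    _ = ∫ r : Ioi (0 : ℝ), ∫ ω : Metric.sphere (0 : EuclideanSpace ℝ (Fin (n + 1))) 1,
          f ((r : ℝ) • (ω : EuclideanSpace ℝ (Fin (n + 1))))
          ∂(sphereMeasure n) ∂(Measure.volumeIoiPow n) :=
      integral_prod_symm _ (integrable_polar hf)
    _ = _ := by
      simp only [Measure.volumeIoiPow, ENNReal.ofReal]
      rw [integral_withDensity_eq_integral_smul,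
        integral_subtype_comap measurableSet_Ioi fun r => Real.toNNReal (r ^ n) •
          ∫ ω : Metric.sphere (0 : EuclideanSpace ℝ (Fin (n + 1))) 1,
            f (r • (ω : EuclideanSpace ℝ (Fin (n + 1)))) ∂(sphereMeasure n),
        setIntegral_congr_fun measurableSet_Ioi fun x hx ↦ ?_]
      · rw [NNReal.smul_def, Real.coe_toNNReal _ (pow_nonneg hx.out.le _), smul_eq_mul]
      · exact (measurable_subtype_coe.pow_const _).real_toNNReal

lemma integrable_weight_sphere {n : ℕ} {a : ℝ} (ha : -1 < a) :
    Integrable (fun ω : Metric.sphere (0 : EuclideanSpace ℝ (Fin (n + 1))) 1 =>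
      weight n a (ω : EuclideanSpace ℝ (Fin (n + 1)))) (sphereMeasure n) := by
  have : SFinite (sphereMeasure n) := by unfold sphereMeasure; infer_instance
  have h := (integrable_polar ((integrable_indicator_iff Metric.isOpen_ball.measurableSet).2
    (integrableOn_weight (n := n) ha 1))).prod_left_ae
  have hpos : Measure.volumeIoiPow n (Iio ⟨1, mem_Ioi.2 one_pos⟩) ≠ 0 := by
    rw [Measure.volumeIoiPow_apply_Iio]
    simp only [one_pow, ne_eq, ENNReal.ofReal_eq_zero, not_le]
    positivity
  obtain ⟨r, hr1, hr⟩ := Measure.exists_mem_of_measure_ne_zero_of_ae hpos (ae_restrict_of_ae h)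
  have hr0 : (0 : ℝ) < r := r.2
  have hr1' : (r : ℝ) < 1 := hr1
  refine (hr.const_mul (((r : ℝ) ^ a)⁻¹)).congr (Filter.Eventually.of_forall fun ω => ?_)
  have hmem : (r : ℝ) • (ω : EuclideanSpace ℝ (Fin (n + 1))) ∈
      Metric.ball (0 : EuclideanSpace ℝ (Fin (n + 1))) 1 := by
    simpa [norm_smul, abs_of_pos hr0] using hr1'
  simp only [indicator_of_mem hmem, weight_smul n a hr0]
  field_simp

lemma isFiniteMeasure_weightedSphereMeasure {n : ℕ} {a : ℝ} (ha : -1 < a) :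
    IsFiniteMeasure (weightedSphereMeasure n a) :=
  isFiniteMeasure_withDensity_ofReal (integrable_weight_sphere ha).2

lemma integral_weightedSphereMeasure (n : ℕ) (a : ℝ)
    (f : Metric.sphere (0 : EuclideanSpace ℝ (Fin (n + 1))) 1 → ℝ) :
    ∫ ω, f ω ∂(weightedSphereMeasure n a) =
      ∫ ω, weight n a (ω : EuclideanSpace ℝ (Fin (n + 1))) * f ω ∂(sphereMeasure n) := by
  rw [weightedSphereMeasure, integral_withDensity_eq_integral_toReal_smul
    (f := fun ω : Metric.sphere (0 : EuclideanSpace ℝ (Fin (n + 1))) 1 =>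
      ENNReal.ofReal (weight n a ω))
    ((measurable_weight n a).comp measurable_subtype_coe).ennreal_ofReal (by simp)]
  simp [ENNReal.toReal_ofReal (weight_nonneg n a _)]

lemma integral_weight_polar {n : ℕ} {a : ℝ} {f : EuclideanSpace ℝ (Fin (n + 1)) → ℝ}
    (hf : Integrable fun X => weight n a X * f X) :
    ∫ X, weight n a X * f X = ∫ r in Ioi (0 : ℝ), r ^ n * (r ^ a *
      ∫ ω : Metric.sphere (0 : EuclideanSpace ℝ (Fin (n + 1))) 1,
        f (r • (ω : EuclideanSpace ℝ (Fin (n + 1)))) ∂(weightedSphereMeasure n a)) := by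
  rw [integral_polar hf]
  refine setIntegral_congr_fun measurableSet_Ioi fun r hr => ?_
  simp only [integral_weightedSphereMeasure, weight_smul n a (mem_Ioi.1 hr), mul_assoc]
  rw [integral_const_mul]

lemma integrable_weight_mul {n : ℕ} {a : ℝ} (ha : -1 < a)
    {f : EuclideanSpace ℝ (Fin (n + 1)) → ℝ} (hf : Continuous f) (hc : HasCompactSupport f) :
    Integrable fun X => weight n a X * f X := by
  obtain ⟨R, hR⟩ := hc.isCompact.isBounded.subset_ball 0
  obtain ⟨C, hC⟩ := hf.bounded_above_of_compact_support hc
  have h1 : IntegrableOn (fun X => weight n a X * f X) (Metric.ball 0 R) :=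
    (integrableOn_weight ha R).mul_bdd (c := C) hf.aestronglyMeasurable
      (Filter.Eventually.of_forall hC)
  refine (integrableOn_iff_integrable_of_support_subset fun X hX => hR ?_).1 h1
  exact subset_tsupport _ (right_ne_zero_of_mul hX)

/-- A smooth function on `ℝ` with compact support contained in `(0, ∞)`. -/
structure IsRadialTest (χ : ℝ → ℝ) : Prop where
  contDiff : ContDiff ℝ (⊤ : ℕ∞) χ
  hasCompactSupport : HasCompactSupport χ
  tsupport_subset : tsupport χ ⊆ Ioi 0

/-- The radial profile `s ↦ ∫_s^∞ t χ(t) dt`, whose composition with the norm has gradient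
`-χ(‖X‖) X`. -/
def radialPrimitive (χ : ℝ → ℝ) (s : ℝ) : ℝ := ∫ t in Ioi s, t * χ t

namespace IsRadialTest

variable {χ : ℝ → ℝ}

lemma exists_bounds (hχ : IsRadialTest χ) :
    ∃ ε M : ℝ, 0 < ε ∧ (∀ t < ε, χ t = 0) ∧ ∀ t, M ≤ t → χ t = 0 := by
  obtain ⟨M, hM⟩ := hχ.hasCompactSupport.isCompact.bddAbove
  have h0 : (0 : ℝ) ∈ (tsupport χ)ᶜ := fun h => lt_irrefl (0 : ℝ) (hχ.tsupport_subset h)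
  obtain ⟨ε, hε, hball⟩ := Metric.isOpen_iff.1 (isClosed_tsupport χ).isOpen_compl 0 h0
  refine ⟨ε, M + 1, hε, fun t ht => ?_, fun t ht => ?_⟩
  · by_contra h
    have hmem : t ∈ tsupport χ := subset_tsupport _ h
    have hpos : 0 < t := hχ.tsupport_subset hmem
    exact hball (by simpa [abs_of_pos hpos] using ht) hmem
  · by_contra h
    have := hM (subset_tsupport _ h)
    linarith

lemma continuous_mul (hχ : IsRadialTest χ) : Continuous fun t => t * χ t :=
  continuous_id.mul hχ.contDiff.continuous

lemma integrable_mul (hχ : IsRadialTest χ) : Integrable fun t => t * χ t :=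
  hχ.continuous_mul.integrable_of_hasCompactSupport hχ.hasCompactSupport.mul_left

lemma radialPrimitive_eq (hχ : IsRadialTest χ) (s : ℝ) :
    radialPrimitive χ s = radialPrimitive χ 0 - ∫ t in (0 : ℝ)..s, t * χ t := by
  rw [← intervalIntegral.integral_Ioi_sub_Ioi' hχ.integrable_mul.integrableOn
    hχ.integrable_mul.integrableOn]
  simp [radialPrimitive]

lemma hasDerivAt_radialPrimitive (hχ : IsRadialTest χ) (s : ℝ) :
    HasDerivAt (radialPrimitive χ) (-(s * χ s)) s := by
  have h := (hχ.continuous_mul.integral_hasStrictDerivAt 0 s).hasDerivAt.const_sub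
    (radialPrimitive χ 0)
  exact h.congr_of_eventuallyEq (Filter.Eventually.of_forall hχ.radialPrimitive_eq)

lemma contDiff_radialPrimitive (hχ : IsRadialTest χ) :
    ContDiff ℝ (⊤ : ℕ∞) (radialPrimitive χ) := by
  refine contDiff_infty_iff_deriv.2
    ⟨fun s => (hχ.hasDerivAt_radialPrimitive s).differentiableAt, ?_⟩
  rw [funext fun s => (hχ.hasDerivAt_radialPrimitive s).deriv]
  exact (contDiff_id.mul hχ.contDiff).neg

lemma exists_radialPrimitive_eq (hχ : IsRadialTest χ) :
    ∃ ε > 0, ∀ s, 0 ≤ s → s < ε → radialPrimitive χ s = radialPrimitive χ 0 := by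
  obtain ⟨ε, M, hε, h1, h2⟩ := hχ.exists_bounds
  refine ⟨ε, hε, fun s hs hsε => ?_⟩
  rw [hχ.radialPrimitive_eq s, sub_eq_self]
  refine intervalIntegral.integral_zero_ae (Filter.Eventually.of_forall fun t ht => ?_)
  rw [uIoc_of_le hs] at ht
  rw [h1 t (by linarith [ht.2]), mul_zero]

variable {E : Type*} [NormedAddCommGroup E]

lemma radialPrimitive_norm_eventuallyEq (hχ : IsRadialTest χ) :
    (fun X : E => radialPrimitive χ ‖X‖) =ᶠ[nhds 0] fun _ => radialPrimitive χ 0 := by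
  obtain ⟨ε, hε, h⟩ := hχ.exists_radialPrimitive_eq
  filter_upwards [Metric.ball_mem_nhds (0 : E) hε] with X hX
  exact h _ (norm_nonneg _) (by simpa using hX)

lemma hasCompactSupport_norm [ProperSpace E] (hχ : IsRadialTest χ) :
    HasCompactSupport fun X : E => χ ‖X‖ := by
  obtain ⟨ε, M, hε, h1, h2⟩ := hχ.exists_bounds
  refine HasCompactSupport.intro (isCompact_closedBall 0 M) fun X hX => h2 _ ?_
  simpa using (not_le.1 (by simpa using hX)).le

lemma hasCompactSupport_radialPrimitive_norm [ProperSpace E] (hχ : IsRadialTest χ) :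
    HasCompactSupport fun X : E => radialPrimitive χ ‖X‖ := by
  obtain ⟨ε, M, hε, h1, h2⟩ := hχ.exists_bounds
  refine HasCompactSupport.intro (isCompact_closedBall 0 M) fun X hX => ?_
  have hX' : M < ‖X‖ := by simpa using hX
  refine setIntegral_eq_zero_of_forall_eq_zero fun t ht => ?_
  rw [h2 t (by linarith [mem_Ioi.1 ht]), mul_zero]

variable [InnerProductSpace ℝ E]

lemma contDiff_radialPrimitive_norm (hχ : IsRadialTest χ) :
    ContDiff ℝ (⊤ : ℕ∞) fun X : E => radialPrimitive χ ‖X‖ := by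
  rw [contDiff_iff_contDiffAt]
  intro X
  rcases eq_or_ne X 0 with rfl | hX
  · exact contDiffAt_const.congr_of_eventuallyEq hχ.radialPrimitive_norm_eventuallyEq
  · exact hχ.contDiff_radialPrimitive.contDiffAt.comp X (contDiffAt_norm ℝ hX)

lemma hasFDerivAt_radialPrimitive_norm (hχ : IsRadialTest χ) (X : E) :
    HasFDerivAt (fun X : E => radialPrimitive χ ‖X‖) (-(χ ‖X‖) • innerSL ℝ X) X := by
  rcases eq_or_ne X 0 with rfl | hX
  · refine ((hasFDerivAt_const (radialPrimitive χ 0) (0 : E)).congr_of_eventuallyEq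
      hχ.radialPrimitive_norm_eventuallyEq).congr_fderiv ?_
    simp
  · have hn : ‖X‖ ≠ 0 := norm_ne_zero_iff.2 hX
    have h1 : HasFDerivAt (fun X : E => ‖X‖) (‖X‖⁻¹ • innerSL ℝ X) X := by
      have h := (hasStrictFDerivAt_norm_sq X).hasFDerivAt.sqrt (pow_ne_zero 2 hn)
      simp only [Real.sqrt_sq (norm_nonneg _)] at h
      refine h.congr_fderiv ?_
      ext Y
      simp
      field_simp
    refine ((hχ.hasDerivAt_radialPrimitive ‖X‖).comp_hasFDerivAt X h1).congr_fderiv ?_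
    rw [smul_smul]
    congr 1
    field_simp

end IsRadialTest

lemma eqOn_Ioi_of_forall_integral_eq {n : ℕ} {a : ℝ} {G₁ G₂ : ℝ → ℝ}
    (h₁ : ContinuousOn G₁ (Ioi 0)) (h₂ : ContinuousOn G₂ (Ioi 0))
    (h : ∀ χ, IsRadialTest χ →
      ∫ r in Ioi (0 : ℝ), r ^ n * (r ^ a * (χ r * G₁ r)) =
        ∫ r in Ioi (0 : ℝ), r ^ n * (r ^ a * (χ r * G₂ r))) :
    EqOn G₁ G₂ (Ioi 0) := by
  have hpow : ContinuousOn (fun r : ℝ => r ^ n * r ^ a) (Ioi 0) := by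
    refine (continuousOn_id.pow n).mul (continuousOn_id.rpow_const fun x hx => Or.inl ?_)
    exact (mem_Ioi.1 hx).ne'
  have hcont : ContinuousOn (fun r => r ^ n * r ^ a * (G₁ r - G₂ r)) (Ioi 0) :=
    hpow.mul (h₁.sub h₂)
  have hint : ∀ (χ G : ℝ → ℝ), IsRadialTest χ → ContinuousOn G (Ioi 0) →
      IntegrableOn (fun r => r ^ n * (r ^ a * (χ r * G r))) (Ioi 0) := by
    intro χ G hχ hG
    have hc : ContinuousOn (fun r => r ^ n * (r ^ a * (χ r * G r))) (tsupport χ) := by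
      refine ((hpow.mul (hχ.contDiff.continuous.continuousOn.mul hG)).mono
        hχ.tsupport_subset).congr fun r _ => ?_
      simp [mul_assoc]
    refine ((integrableOn_iff_integrable_of_support_subset fun r hr => ?_).1
      (hc.integrableOn_compact hχ.hasCompactSupport.isCompact)).integrableOn
    refine subset_tsupport _ fun h0 => hr ?_
    simp [h0]
  have hae := isOpen_Ioi.ae_eq_zero_of_integral_contDiff_smul_eq_zero (μ := volume)
    (hcont.locallyIntegrableOn measurableSet_Ioi) fun g hg1 hg2 hg3 => by
      have hg : IsRadialTest g := ⟨hg1, hg2, hg3⟩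
      rw [← setIntegral_eq_integral_of_forall_compl_eq_zero (s := Ioi 0) fun r hr => ?_]
      · have := sub_eq_zero.2 (h g hg)
        rw [← integral_sub (hint g G₁ hg h₁) (hint g G₂ hg h₂)] at this
        refine Eq.trans ?_ this
        refine integral_congr_ae (Filter.Eventually.of_forall fun r => ?_)
        simp only [smul_eq_mul]
        ring
      · have : g r = 0 := by
          by_contra h0
          exact hr (hg3 (subset_tsupport _ h0))
        simp [this]
  have hEq : EqOn (fun r => r ^ n * r ^ a * (G₁ r - G₂ r)) (fun _ => 0) (Ioi 0) :=
    Measure.eqOn_open_of_ae_eq (μ := volume)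
      ((ae_restrict_iff' measurableSet_Ioi).2 hae) isOpen_Ioi hcont continuousOn_const
  intro r hr
  have hr0 : 0 < r := hr
  have hne : r ^ n * r ^ a ≠ 0 := (mul_pos (pow_pos hr0 n) (Real.rpow_pos_of_pos hr0 a)).ne'
  exact sub_eq_zero.1 ((mul_eq_zero.1 (hEq hr)).resolve_left hne)

lemma integral_mul_radialPrimitive {n : ℕ} {h : EuclideanSpace ℝ (Fin (n + 1)) → ℝ}
    (hh : ∀ R : ℝ, IntegrableOn h (Metric.ball 0 R)) {χ : ℝ → ℝ} (hχ : IsRadialTest χ) :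
    ∫ X, h X * radialPrimitive χ ‖X‖ =
      ∫ t in Ioi (0 : ℝ), t * χ t * ∫ X in Metric.ball 0 t, h X := by
  obtain ⟨ε, M, hε, h1, h2⟩ := hχ.exists_bounds
  let s : Set (EuclideanSpace ℝ (Fin (n + 1)) × ℝ) := {z | ‖z.1‖ < z.2}
  have hs : MeasurableSet s := (isOpen_lt (by fun_prop) (by fun_prop)).measurableSet
  let F : EuclideanSpace ℝ (Fin (n + 1)) × ℝ → ℝ := s.indicator fun z => h z.1 * (z.2 * χ z.2)
  have hF : Integrable F (volume.prod (volume.restrict (Ioi 0))) := by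
    have hb : Integrable ((Metric.ball 0 M).indicator h) :=
      (integrable_indicator_iff Metric.isOpen_ball.measurableSet).2 (hh M)
    refine ((hb.mul_prod (hχ.integrable_mul.restrict (s := Ioi 0))).indicator hs).congr
      (Filter.Eventually.of_forall fun z => ?_)
    by_cases hz : z ∈ s
    · simp only [F, indicator_of_mem hz]
      by_cases hM : z.2 < M
      · have : z.1 ∈ Metric.ball (0 : EuclideanSpace ℝ (Fin (n + 1))) M := by
          have : ‖z.1‖ < z.2 := hz
          simpa using this.trans hM
        rw [indicator_of_mem this]
      · simp [h2 z.2 (not_lt.1 hM)]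
    · simp only [F, indicator_of_notMem hz]
  have hswap := integral_integral_swap (f := fun X t => F (X, t)) hF
  calc
    ∫ X, h X * radialPrimitive χ ‖X‖ = ∫ X, ∫ t in Ioi (0 : ℝ), F (X, t) := by
      refine integral_congr_ae (Filter.Eventually.of_forall fun X => ?_)
      have hX : (fun t => F (X, t)) = (Ioi ‖X‖).indicator fun t => h X * (t * χ t) := by
        ext t
        by_cases ht : ‖X‖ < t <;> simp [F, s, indicator, ht]
      simp only [hX, radialPrimitive]
      rw [setIntegral_indicator measurableSet_Ioi, Ioi_inter_Ioi,
        sup_eq_right.2 (norm_nonneg X), integral_const_mul]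
    _ = ∫ t in Ioi (0 : ℝ), ∫ X, F (X, t) := hswap
    _ = _ := by
      refine integral_congr_ae (Filter.Eventually.of_forall fun t => ?_)
      have ht : (fun X => F (X, t)) = (Metric.ball 0 t).indicator fun X => h X * (t * χ t) := by
        ext X
        by_cases hX : ‖X‖ < t <;> simp [F, s, indicator, hX]
      simp only [ht]
      rw [integral_indicator Metric.isOpen_ball.measurableSet, integral_mul_const, mul_comm]

/-- A smooth solution of `div(|y|^a ∇u) = 0` on `ℝ^{n+1}`, in the weak sense. -/
structure IsWeightedHarmonic (n : ℕ) (a : ℝ) (u : EuclideanSpace ℝ (Fin (n + 1)) → ℝ) : Prop where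
  contDiff : ContDiff ℝ (⊤ : ℕ∞) u
  integral_eq_zero : ∀ φ : EuclideanSpace ℝ (Fin (n + 1)) → ℝ,
    ContDiff ℝ (⊤ : ℕ∞) φ → HasCompactSupport φ →
    ∫ X, weight n a X * ⟪gradient u X, gradient φ X⟫ = 0

section EulerField

variable {E : Type*} [NormedAddCommGroup E] [NormedSpace ℝ E]

/-- The derivative `X · ∇u(X)` of `u` along the Euler vector field. -/
def eulerDeriv (u : E → ℝ) (X : E) : ℝ := fderiv ℝ u X X

lemma continuous_eulerDeriv {u : E → ℝ} (hu : ContDiff ℝ (⊤ : ℕ∞) u) :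
    Continuous (eulerDeriv u) :=
  (hu.continuous_fderiv (by simp)).clm_apply continuous_id

lemma eulerDeriv_comp_smul {u : E → ℝ} (hu : ContDiff ℝ (⊤ : ℕ∞) u) (c : ℝ) (X : E) :
    eulerDeriv (fun Y => u (c • Y)) X = eulerDeriv u (c • X) := by
  have h1 : HasFDerivAt (fun Y : E => c • Y) (c • ContinuousLinearMap.id ℝ E) X :=
    (hasFDerivAt_id X).const_smul c
  have h2 := ((hu.differentiable (by simp)) (c • X)).hasFDerivAt.comp X h1
  change fderiv ℝ (u ∘ fun Y => c • Y) X X = _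
  rw [h2.fderiv]
  simp [eulerDeriv]

lemma hasDerivAt_comp_exp_smul {u : E → ℝ} (hu : ContDiff ℝ (⊤ : ℕ∞) u) (X : E) (τ : ℝ) :
    HasDerivAt (fun τ => u (Real.exp τ • X)) (eulerDeriv u (Real.exp τ • X)) τ := by
  have h1 : HasDerivAt (fun τ : ℝ => Real.exp τ • X) (Real.exp τ • X) τ :=
    (Real.hasDerivAt_exp τ).smul_const X
  exact ((hu.differentiable (by simp)) (Real.exp τ • X)).hasFDerivAt.comp_hasDerivAt τ h1

end EulerField

lemma gradient_comp_smul {E : Type*} [NormedAddCommGroup E] [InnerProductSpace ℝ E]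
    [CompleteSpace E] {u : E → ℝ} (hu : Differentiable ℝ u) (c : ℝ) (X : E) :
    gradient (fun Y => u (c • Y)) X = c • gradient u (c • X) := by
  refine HasGradientAt.gradient ?_
  rw [hasGradientAt_iff_hasFDerivAt]
  have h1 : HasFDerivAt (fun Y : E => c • Y) (c • ContinuousLinearMap.id ℝ E) X :=
    (hasFDerivAt_id X).const_smul c
  have h2 := (hasGradientAt_iff_hasFDerivAt.1 (hu (c • X)).hasGradientAt).comp X h1
  refine h2.congr_fderiv ?_
  ext Y
  simp

lemma continuous_gradient {E : Type*} [NormedAddCommGroup E] [InnerProductSpace ℝ E]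
    [CompleteSpace E] {u : E → ℝ} (hu : ContDiff ℝ (⊤ : ℕ∞) u) : Continuous (gradient u) :=
  (InnerProductSpace.toDual ℝ E).symm.continuous.comp (hu.continuous_fderiv (by simp))

namespace IsWeightedHarmonic

variable {n : ℕ} {a : ℝ} {u v : EuclideanSpace ℝ (Fin (n + 1)) → ℝ}

lemma comp_smul (hu : IsWeightedHarmonic n a u) {c : ℝ} (hc : 0 < c) :
    IsWeightedHarmonic n a fun X => u (c • X) := by
  refine ⟨hu.contDiff.comp (contDiff_const_smul c), fun φ hφ hφc => ?_⟩
  let φ' : EuclideanSpace ℝ (Fin (n + 1)) → ℝ := fun X => φ (c⁻¹ • X)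
  have hφ' : ContDiff ℝ (⊤ : ℕ∞) φ' := hφ.comp (contDiff_const_smul c⁻¹)
  have hφc' : HasCompactSupport φ' := hφc.comp_smul (inv_ne_zero hc.ne')
  have hφeq : φ = fun X => φ' (c • X) := by
    ext X
    simp [φ', smul_smul, inv_mul_cancel₀ hc.ne']
  have hzero := hu.integral_eq_zero φ' hφ' hφc'
  have hscale := Measure.integral_comp_smul volume
    (fun Y => weight n a Y * ⟪gradient u Y, gradient φ' Y⟫) c
  rw [hzero, smul_zero] at hscale
  calc
    _ = ∫ X, c ^ 2 * (c ^ a)⁻¹ *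
        (weight n a (c • X) * ⟪gradient u (c • X), gradient φ' (c • X)⟫) := by
      refine integral_congr_ae (Filter.Eventually.of_forall fun X => ?_)
      have hca : c ^ a ≠ 0 := (Real.rpow_pos_of_pos hc a).ne'
      have hg : gradient φ X = c • gradient φ' (c • X) := by
        conv_lhs => rw [hφeq]
        exact gradient_comp_smul (hφ'.differentiable (by simp)) c X
      simp only [hg, gradient_comp_smul (hu.contDiff.differentiable (by simp)), weight_smul n a hc,
        real_inner_smul_left, real_inner_smul_right]
      field_simp
    _ = 0 := by rw [integral_const_mul, hscale, mul_zero]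

/-- Testing the equation against `Ψ(‖X‖) v` with `Ψ` the radial primitive of `χ`. -/
lemma integral_radialPrimitive_mul_inner (ha : -1 < a) (hu : IsWeightedHarmonic n a u)
    (hv : ContDiff ℝ (⊤ : ℕ∞) v) {χ : ℝ → ℝ} (hχ : IsRadialTest χ) :
    ∫ X, weight n a X * (radialPrimitive χ ‖X‖ * ⟪gradient u X, gradient v X⟫) =
      ∫ X, weight n a X * (χ ‖X‖ * (v X * eulerDeriv u X)) := by
  have hzero := hu.integral_eq_zero (fun X => radialPrimitive χ ‖X‖ * v X)
    (hχ.contDiff_radialPrimitive_norm.mul hv) hχ.hasCompactSupport_radialPrimitive_norm.mul_right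
  have hI1 := integrable_weight_mul ha
    (f := fun X => radialPrimitive χ ‖X‖ * ⟪gradient u X, gradient v X⟫)
    (hχ.contDiff_radialPrimitive_norm.continuous.mul
      ((continuous_gradient hu.contDiff).inner (𝕜 := ℝ) (continuous_gradient hv)))
    hχ.hasCompactSupport_radialPrimitive_norm.mul_right
  have hI2 := integrable_weight_mul ha (f := fun X => χ ‖X‖ * (v X * eulerDeriv u X))
    ((hχ.contDiff.continuous.comp continuous_norm).mul
      (hv.continuous.mul (continuous_eulerDeriv hu.contDiff)))
    hχ.hasCompactSupport_norm.mul_right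
  rw [← sub_eq_zero, ← integral_sub hI1 hI2, ← hzero]
  refine integral_congr_ae (Filter.Eventually.of_forall fun X => ?_)
  have hd := (hχ.hasFDerivAt_radialPrimitive_norm X).fun_mul
    (hv.differentiable (by simp) X).hasFDerivAt
  simp only [inner_gradient_right]
  rw [hd.fderiv]
  simp [eulerDeriv]
  ring

end IsWeightedHarmonic

section Sphere

variable {n : ℕ} {a : ℝ} {u v : EuclideanSpace ℝ (Fin (n + 1)) → ℝ}

lemma continuous_integral_sphere (ha : -1 < a) {f : EuclideanSpace ℝ (Fin (n + 1)) → ℝ}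
    (hf : Continuous f) :
    Continuous fun r : ℝ => ∫ ω : Metric.sphere (0 : EuclideanSpace ℝ (Fin (n + 1))) 1,
      f (r • (ω : EuclideanSpace ℝ (Fin (n + 1)))) ∂(weightedSphereMeasure n a) := by
  have := isFiniteMeasure_weightedSphereMeasure (n := n) ha
  have h := continuous_parametric_integral_of_continuous (μ := weightedSphereMeasure n a)
    (f := fun (r : ℝ) (ω : Metric.sphere (0 : EuclideanSpace ℝ (Fin (n + 1))) 1) =>
      f (r • (ω : EuclideanSpace ℝ (Fin (n + 1))))) (by
        unfold Function.uncurry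
        fun_prop) isCompact_univ
  simpa using h

lemma integral_weight_mul_radial (ha : -1 < a) {f : EuclideanSpace ℝ (Fin (n + 1)) → ℝ}
    (hf : Continuous f) {χ : ℝ → ℝ} (hχ : Continuous χ)
    (hc : HasCompactSupport fun X : EuclideanSpace ℝ (Fin (n + 1)) => χ ‖X‖) :
    ∫ X, weight n a X * (χ ‖X‖ * f X) = ∫ r in Ioi (0 : ℝ), r ^ n * (r ^ a * (χ r *
      ∫ ω : Metric.sphere (0 : EuclideanSpace ℝ (Fin (n + 1))) 1,
        f (r • (ω : EuclideanSpace ℝ (Fin (n + 1)))) ∂(weightedSphereMeasure n a))) := by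
  rw [integral_weight_polar (f := fun X => χ ‖X‖ * f X)
    (integrable_weight_mul ha ((hχ.comp continuous_norm).mul hf) hc.mul_right)]
  refine setIntegral_congr_fun measurableSet_Ioi fun r hr => ?_
  simp [norm_smul, abs_of_pos (mem_Ioi.1 hr), integral_const_mul]

/-- Green's identity on spheres. -/
lemma IsWeightedHarmonic.integral_sphere_mul_eulerDeriv_comm (ha : -1 < a)
    (hu : IsWeightedHarmonic n a u) (hv : IsWeightedHarmonic n a v) {r : ℝ} (hr : 0 < r) :
    ∫ ω : Metric.sphere (0 : EuclideanSpace ℝ (Fin (n + 1))) 1,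
        v (r • (ω : EuclideanSpace ℝ (Fin (n + 1)))) *
          eulerDeriv u (r • (ω : EuclideanSpace ℝ (Fin (n + 1)))) ∂(weightedSphereMeasure n a) =
      ∫ ω : Metric.sphere (0 : EuclideanSpace ℝ (Fin (n + 1))) 1,
        u (r • (ω : EuclideanSpace ℝ (Fin (n + 1)))) *
          eulerDeriv v (r • (ω : EuclideanSpace ℝ (Fin (n + 1)))) ∂(weightedSphereMeasure n a) := by
  have hvu := hv.contDiff.continuous.mul (continuous_eulerDeriv hu.contDiff)
  have huv := hu.contDiff.continuous.mul (continuous_eulerDeriv hv.contDiff)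
  refine eqOn_Ioi_of_forall_integral_eq (n := n) (a := a)
    (continuous_integral_sphere ha hvu).continuousOn
    (continuous_integral_sphere ha huv).continuousOn (fun χ hχ => ?_) (mem_Ioi.2 hr)
  rw [← integral_weight_mul_radial ha hvu hχ.contDiff.continuous hχ.hasCompactSupport_norm,
    ← integral_weight_mul_radial ha huv hχ.contDiff.continuous hχ.hasCompactSupport_norm]
  have h1 := hu.integral_radialPrimitive_mul_inner ha hv.contDiff hχ
  have h2 := hv.integral_radialPrimitive_mul_inner ha hu.contDiff hχ
  simp only [Pi.mul_apply]
  rw [← h1, ← h2]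
  simp only [real_inner_comm]

lemma IsWeightedHarmonic.integral_exp_smul_mul_eulerDeriv_comm (ha : -1 < a)
    (hu : IsWeightedHarmonic n a u) (α β : ℝ) :
    ∫ ω : Metric.sphere (0 : EuclideanSpace ℝ (Fin (n + 1))) 1,
        u (Real.exp α • (ω : EuclideanSpace ℝ (Fin (n + 1)))) *
          eulerDeriv u (Real.exp β • (ω : EuclideanSpace ℝ (Fin (n + 1))))
          ∂(weightedSphereMeasure n a) =
      ∫ ω : Metric.sphere (0 : EuclideanSpace ℝ (Fin (n + 1))) 1,
        u (Real.exp β • (ω : EuclideanSpace ℝ (Fin (n + 1)))) *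
          eulerDeriv u (Real.exp α • (ω : EuclideanSpace ℝ (Fin (n + 1))))
          ∂(weightedSphereMeasure n a) := by
  have h := hu.integral_sphere_mul_eulerDeriv_comm ha (hu.comp_smul (Real.exp_pos (α - β)))
    (Real.exp_pos β)
  simpa only [eulerDeriv_comp_smul hu.contDiff, smul_smul, ← Real.exp_add, sub_add_cancel] using h

lemma hasDerivAt_integral_of_continuous {S : Type*} [TopologicalSpace S] [CompactSpace S]
    [SecondCountableTopology S] [MeasurableSpace S] [OpensMeasurableSpace S] (ν : Measure S)
    [IsFiniteMeasure ν] {A A' : ℝ → S → ℝ} (hA : Continuous A.uncurry)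
    (hA' : Continuous A'.uncurry) (hd : ∀ τ ω, HasDerivAt (fun t => A t ω) (A' τ ω) τ) (τ : ℝ) :
    HasDerivAt (fun t => ∫ ω, A t ω ∂ν) (∫ ω, A' τ ω ∂ν) τ := by
  obtain ⟨C, hC⟩ := ((isCompact_closedBall τ 1).prod (isCompact_univ (X := S))).exists_bound_of_continuousOn
    hA'.continuousOn
  have hAc : ∀ t, Continuous (A t) := fun t => hA.comp (Continuous.prodMk_right t)
  have hAc' : ∀ t, Continuous (A' t) := fun t => hA'.comp (Continuous.prodMk_right t)
  have hint : Integrable (A τ) ν := by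
    obtain ⟨B, hB⟩ := (isCompact_univ (X := S)).exists_bound_of_continuousOn (hAc τ).continuousOn
    exact Integrable.of_bound (hAc τ).aestronglyMeasurable B
      (Filter.Eventually.of_forall fun ω => hB ω (mem_univ ω))
  refine (hasDerivAt_integral_of_dominated_loc_of_deriv_le (bound := fun _ => C)
    (Metric.closedBall_mem_nhds τ one_pos)
    (Filter.Eventually.of_forall fun t => (hAc t).aestronglyMeasurable) hint
    (hAc' τ).aestronglyMeasurable (Filter.Eventually.of_forall fun ω t ht => ?_)
    (integrable_const C) (Filter.Eventually.of_forall fun ω t _ => hd t ω)).2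
  exact hC (t, ω) ⟨ht, mem_univ ω⟩

end Sphere

/-- The weighted `L²` pairing on the unit sphere of the restrictions of `u` to the spheres of radii
`exp α` and `exp β`. -/
def spherePairing (n : ℕ) (a : ℝ) (u : EuclideanSpace ℝ (Fin (n + 1)) → ℝ) (α β : ℝ) : ℝ :=
  ∫ ω : Metric.sphere (0 : EuclideanSpace ℝ (Fin (n + 1))) 1,
    u (Real.exp α • (ω : EuclideanSpace ℝ (Fin (n + 1)))) *
      u (Real.exp β • (ω : EuclideanSpace ℝ (Fin (n + 1)))) ∂(weightedSphereMeasure n a)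

section Frequency

variable {n : ℕ} {a k : ℝ} {u : EuclideanSpace ℝ (Fin (n + 1)) → ℝ}

lemma integrable_sphere (ha : -1 < a)
    {f : Metric.sphere (0 : EuclideanSpace ℝ (Fin (n + 1))) 1 → ℝ} (hf : Continuous f) :
    Integrable f (weightedSphereMeasure n a) := by
  have := isFiniteMeasure_weightedSphereMeasure (n := n) ha
  obtain ⟨B, hB⟩ := (isCompact_univ (X := Metric.sphere (0 : EuclideanSpace ℝ (Fin (n + 1))) 1)
    ).exists_bound_of_continuousOn hf.continuousOn
  exact Integrable.of_bound hf.aestronglyMeasurable B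
    (Filter.Eventually.of_forall fun ω => hB ω (mem_univ ω))

lemma IsWeightedHarmonic.spherePairing_eq_diag (ha : -1 < a) (hu : IsWeightedHarmonic n a u)
    (α β : ℝ) :
    spherePairing n a u α β = spherePairing n a u ((α + β) / 2) ((α + β) / 2) := by
  have := isFiniteMeasure_weightedSphereMeasure (n := n) ha
  have hc := hu.contDiff.continuous
  have hc' := continuous_eulerDeriv hu.contDiff
  set m := (α + β) / 2 with hm
  have hd : ∀ τ, HasDerivAt (fun t => spherePairing n a u (m + t) (m - t)) 0 τ := by
    intro τ
    have h := hasDerivAt_integral_of_continuous (weightedSphereMeasure n a)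
      (A := fun t (ω : Metric.sphere (0 : EuclideanSpace ℝ (Fin (n + 1))) 1) =>
        u (Real.exp (m + t) • (ω : EuclideanSpace ℝ (Fin (n + 1)))) *
          u (Real.exp (m - t) • (ω : EuclideanSpace ℝ (Fin (n + 1)))))
      (A' := fun t (ω : Metric.sphere (0 : EuclideanSpace ℝ (Fin (n + 1))) 1) =>
        u (Real.exp (m - t) • (ω : EuclideanSpace ℝ (Fin (n + 1)))) *
            eulerDeriv u (Real.exp (m + t) • (ω : EuclideanSpace ℝ (Fin (n + 1)))) -
          u (Real.exp (m + t) • (ω : EuclideanSpace ℝ (Fin (n + 1)))) *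
            eulerDeriv u (Real.exp (m - t) • (ω : EuclideanSpace ℝ (Fin (n + 1)))))
      (by unfold Function.uncurry; fun_prop) (by unfold Function.uncurry; fun_prop)
      (fun t ω => by
        have h1 := (hasDerivAt_comp_exp_smul hu.contDiff
          (ω : EuclideanSpace ℝ (Fin (n + 1))) (m + t)).comp_const_add m t
        have h2 := (hasDerivAt_comp_exp_smul hu.contDiff
          (ω : EuclideanSpace ℝ (Fin (n + 1))) (m - t)).comp_const_sub m t
        exact (h1.mul h2).congr_deriv (by ring)) τ
    refine h.congr_deriv ?_
    rw [integral_sub (integrable_sphere ha (by fun_prop)) (integrable_sphere ha (by fun_prop)),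
      hu.integral_exp_smul_mul_eulerDeriv_comm ha, sub_self]
  have h := is_const_of_deriv_eq_zero (fun τ => (hd τ).differentiableAt)
    (fun τ => (hd τ).deriv) ((α - β) / 2) 0
  simp only [add_zero, sub_zero] at h
  rw [← h, hm]
  congr 1 <;> ring

lemma spherePairing_diag (ha : -1 < a) (hu : ContDiff ℝ (⊤ : ℕ∞) u)
    (hk : ∀ τ, ∫ ω : Metric.sphere (0 : EuclideanSpace ℝ (Fin (n + 1))) 1,
        u (Real.exp τ • (ω : EuclideanSpace ℝ (Fin (n + 1)))) *
          eulerDeriv u (Real.exp τ • (ω : EuclideanSpace ℝ (Fin (n + 1))))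
          ∂(weightedSphereMeasure n a) = k * spherePairing n a u τ τ) (τ : ℝ) :
    spherePairing n a u τ τ = Real.exp (2 * k * τ) * spherePairing n a u 0 0 := by
  have := isFiniteMeasure_weightedSphereMeasure (n := n) ha
  have hc := hu.continuous
  have hc' := continuous_eulerDeriv hu
  have hd : ∀ τ, HasDerivAt (fun t => spherePairing n a u t t)
      (2 * (k * spherePairing n a u τ τ)) τ := by
    intro τ
    have h := hasDerivAt_integral_of_continuous (weightedSphereMeasure n a)
      (A := fun t (ω : Metric.sphere (0 : EuclideanSpace ℝ (Fin (n + 1))) 1) =>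
        u (Real.exp t • (ω : EuclideanSpace ℝ (Fin (n + 1)))) *
          u (Real.exp t • (ω : EuclideanSpace ℝ (Fin (n + 1)))))
      (A' := fun t (ω : Metric.sphere (0 : EuclideanSpace ℝ (Fin (n + 1))) 1) =>
        2 * (u (Real.exp t • (ω : EuclideanSpace ℝ (Fin (n + 1)))) *
            eulerDeriv u (Real.exp t • (ω : EuclideanSpace ℝ (Fin (n + 1))))))
      (by unfold Function.uncurry; fun_prop) (by unfold Function.uncurry; fun_prop)
      (fun t ω => by
        have h1 := hasDerivAt_comp_exp_smul hu (ω : EuclideanSpace ℝ (Fin (n + 1))) t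
        exact (h1.mul h1).congr_deriv (by ring)) τ
    refine h.congr_deriv ?_
    rw [integral_const_mul, hk]
  have hd2 : ∀ τ, HasDerivAt (fun t => Real.exp (-(2 * k * t)) * spherePairing n a u t t) 0 τ := by
    intro τ
    have h1 : HasDerivAt (fun t => Real.exp (-(2 * k * t)))
        (Real.exp (-(2 * k * τ)) * -(2 * k)) τ := by
      have := ((hasDerivAt_id τ).const_mul (2 * k)).neg.exp
      simpa using this
    exact (h1.mul (hd τ)).congr_deriv (by ring)
  have h := is_const_of_deriv_eq_zero (fun τ => (hd2 τ).differentiableAt)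
    (fun τ => (hd2 τ).deriv) τ 0
  simp only [mul_zero, neg_zero, Real.exp_zero, one_mul] at h
  rw [← h, ← mul_assoc, ← Real.exp_add, add_neg_cancel, Real.exp_zero, one_mul]

lemma IsWeightedHarmonic.integral_sq_sub_eq_zero (ha : -1 < a) (hu : IsWeightedHarmonic n a u)
    (hdiag : ∀ τ, spherePairing n a u τ τ = Real.exp (2 * k * τ) * spherePairing n a u 0 0)
    (s τ : ℝ) :
    ∫ ω : Metric.sphere (0 : EuclideanSpace ℝ (Fin (n + 1))) 1,
      (u (Real.exp (s + τ) • (ω : EuclideanSpace ℝ (Fin (n + 1)))) -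
        Real.exp (k * s) * u (Real.exp τ • (ω : EuclideanSpace ℝ (Fin (n + 1))))) ^ 2
      ∂(weightedSphereMeasure n a) = 0 := by
  have hc := hu.contDiff.continuous
  have hint : ∀ α β c : ℝ, Integrable
      (fun ω : Metric.sphere (0 : EuclideanSpace ℝ (Fin (n + 1))) 1 =>
        c * (u (Real.exp α • (ω : EuclideanSpace ℝ (Fin (n + 1)))) *
          u (Real.exp β • (ω : EuclideanSpace ℝ (Fin (n + 1))))))
      (weightedSphereMeasure n a) := fun α β c => integrable_sphere ha (by fun_prop)
  calc
    _ = ∫ ω : Metric.sphere (0 : EuclideanSpace ℝ (Fin (n + 1))) 1,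
        (1 * (u (Real.exp (s + τ) • (ω : EuclideanSpace ℝ (Fin (n + 1)))) *
          u (Real.exp (s + τ) • (ω : EuclideanSpace ℝ (Fin (n + 1))))) -
        (2 * Real.exp (k * s)) * (u (Real.exp (s + τ) • (ω : EuclideanSpace ℝ (Fin (n + 1)))) *
          u (Real.exp τ • (ω : EuclideanSpace ℝ (Fin (n + 1)))))) +
        Real.exp (k * s) ^ 2 * (u (Real.exp τ • (ω : EuclideanSpace ℝ (Fin (n + 1)))) *
          u (Real.exp τ • (ω : EuclideanSpace ℝ (Fin (n + 1))))) ∂(weightedSphereMeasure n a) := by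
      refine integral_congr_ae (Filter.Eventually.of_forall fun ω => ?_)
      ring
    _ = 1 * spherePairing n a u (s + τ) (s + τ) -
        2 * Real.exp (k * s) * spherePairing n a u (s + τ) τ +
        Real.exp (k * s) ^ 2 * spherePairing n a u τ τ := by
      rw [integral_add (integrable_sphere ha (by fun_prop)) (hint _ _ _),
        integral_sub (hint _ _ _) (hint _ _ _), integral_const_mul, integral_const_mul,
        integral_const_mul]
      rfl
    _ = 0 := by
      have e1 : Real.exp (2 * k * (s + τ)) = Real.exp (k * s) ^ 2 * Real.exp (2 * k * τ) := by
        rw [← Real.exp_nat_mul, ← Real.exp_add]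
        congr 1
        push_cast
        ring
      have e2 : Real.exp (2 * k * ((s + τ + τ) / 2)) = Real.exp (k * s) * Real.exp (2 * k * τ) := by
        rw [← Real.exp_add]
        congr 1
        ring
      rw [hu.spherePairing_eq_diag ha (s + τ) τ, hdiag (s + τ), hdiag τ,
        hdiag ((s + τ + τ) / 2), e1, e2]
      ring

/-- The energy identity `∫_{B_r} |y|^a |∇u|² = ∫_{∂B_r} |y|^a u ∂_r u`, combined with the hypothesis
that the Dirichlet energy is `k r^{n+a-1}` times the weighted square mean. -/
lemma IsWeightedHarmonic.integral_sphere_mul_eulerDeriv (ha : -1 < a)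
    (hu : IsWeightedHarmonic n a u)
    (hN : ∀ r : ℝ, 0 < r → ∫ X in Metric.ball (0 : EuclideanSpace ℝ (Fin (n + 1))) r,
        weight n a X * ‖gradient u X‖ ^ 2 =
      r ^ ((n : ℝ) + a - 1) * (k * ∫ ω : Metric.sphere (0 : EuclideanSpace ℝ (Fin (n + 1))) 1,
        u (r • (ω : EuclideanSpace ℝ (Fin (n + 1)))) ^ 2 ∂(weightedSphereMeasure n a)))
    {r : ℝ} (hr : 0 < r) :
    ∫ ω : Metric.sphere (0 : EuclideanSpace ℝ (Fin (n + 1))) 1,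
        u (r • (ω : EuclideanSpace ℝ (Fin (n + 1)))) *
          eulerDeriv u (r • (ω : EuclideanSpace ℝ (Fin (n + 1)))) ∂(weightedSphereMeasure n a) =
      k * ∫ ω : Metric.sphere (0 : EuclideanSpace ℝ (Fin (n + 1))) 1,
        u (r • (ω : EuclideanSpace ℝ (Fin (n + 1)))) ^ 2 ∂(weightedSphereMeasure n a) := by
  have hc := hu.contDiff.continuous
  have huu := hc.mul (continuous_eulerDeriv hu.contDiff)
  have hg := continuous_gradient hu.contDiff
  refine eqOn_Ioi_of_forall_integral_eq (n := n) (a := a)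
    (continuous_integral_sphere ha huu).continuousOn
    ((continuous_integral_sphere ha (hc.pow 2)).const_mul k).continuousOn (fun χ hχ => ?_)
    (mem_Ioi.2 hr)
  have hloc : ∀ R : ℝ, IntegrableOn (fun X => weight n a X * ‖gradient u X‖ ^ 2)
      (Metric.ball 0 R) := by
    intro R
    obtain ⟨C, hC⟩ := (isCompact_closedBall (0 : EuclideanSpace ℝ (Fin (n + 1))) R
      ).exists_bound_of_continuousOn (f := fun X => ‖gradient u X‖ ^ 2) (by fun_prop)
    exact (integrableOn_weight ha R).mul_bdd (c := C) (by fun_prop)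
      ((ae_restrict_iff' Metric.isOpen_ball.measurableSet).2
        (Filter.Eventually.of_forall fun X hX => hC X (Metric.ball_subset_closedBall hX)))
  rw [← integral_weight_mul_radial ha huu hχ.contDiff.continuous hχ.hasCompactSupport_norm]
  simp only [Pi.mul_apply, Pi.pow_apply]
  rw [← hu.integral_radialPrimitive_mul_inner ha hu.contDiff hχ]
  calc
    _ = ∫ X, weight n a X * ‖gradient u X‖ ^ 2 * radialPrimitive χ ‖X‖ := by
      refine integral_congr_ae (Filter.Eventually.of_forall fun X => ?_)
      simp only [real_inner_self_eq_norm_sq]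
      ring
    _ = _ := by
      rw [integral_mul_radialPrimitive hloc hχ]
      refine setIntegral_congr_fun measurableSet_Ioi fun t ht => ?_
      have ht0 : 0 < t := ht
      have hpow : t ^ ((n : ℝ) + a - 1) * t = t ^ n * t ^ a := by
        rw [Real.rpow_sub ht0, Real.rpow_add ht0, Real.rpow_natCast, Real.rpow_one]
        field_simp
      simp only [hN t ht0]
      linear_combination (χ t * (k * ∫ ω : Metric.sphere (0 : EuclideanSpace ℝ (Fin (n + 1))) 1,
        u (t • (ω : EuclideanSpace ℝ (Fin (n + 1)))) ^ 2 ∂(weightedSphereMeasure n a))) * hpow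

lemma ae_weight_ne_zero (n : ℕ) (a : ℝ) :
    ∀ᵐ X : EuclideanSpace ℝ (Fin (n + 1)), weight n a X ≠ 0 := by
  let H : Submodule ℝ (EuclideanSpace ℝ (Fin (n + 1))) :=
    LinearMap.ker (EuclideanSpace.proj (𝕜 := ℝ) (Fin.last n)).toLinearMap
  have hH : H ≠ ⊤ := by
    intro h
    have : EuclideanSpace.single (Fin.last n) (1 : ℝ) ∈ H := h ▸ Submodule.mem_top
    simp [H] at this
  filter_upwards [measure_eq_zero_iff_ae_notMem.1 (Measure.addHaar_submodule volume H hH)] with X hX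
  refine (Real.rpow_pos_of_pos (abs_pos.2 fun h0 => hX ?_) a).ne'
  simpa [H] using h0

/-- A continuous function whose weighted square integral vanishes on every sphere is zero. -/
lemma eq_zero_of_integral_sphere_sq_eq_zero (ha : -1 < a)
    {f : EuclideanSpace ℝ (Fin (n + 1)) → ℝ} (hf : Continuous f)
    (h : ∀ r : ℝ, 0 < r → ∫ ω : Metric.sphere (0 : EuclideanSpace ℝ (Fin (n + 1))) 1,
      f (r • (ω : EuclideanSpace ℝ (Fin (n + 1)))) ^ 2 ∂(weightedSphereMeasure n a) = 0)
    (X : EuclideanSpace ℝ (Fin (n + 1))) : f X = 0 := by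
  have hcut : Continuous fun r : ℝ => max (‖X‖ + 1 - r) 0 := by fun_prop
  have hcs : HasCompactSupport
      fun Y : EuclideanSpace ℝ (Fin (n + 1)) => max (‖X‖ + 1 - ‖Y‖) 0 := by
    refine HasCompactSupport.intro (isCompact_closedBall 0 (‖X‖ + 1)) fun Y hY => ?_
    have : ‖X‖ + 1 < ‖Y‖ := by simpa using hY
    exact max_eq_right (by linarith)
  have hzero := integral_weight_mul_radial ha (f := fun Y => f Y ^ 2) (hf.pow 2) hcut hcs
  rw [setIntegral_eq_zero_of_forall_eq_zero
    (fun r hr => by simp only [h r hr, mul_zero]),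
    integral_eq_zero_iff_of_nonneg
      (fun Y => mul_nonneg (weight_nonneg n a Y) (mul_nonneg (le_max_right _ _) (sq_nonneg _)))
      (integrable_weight_mul ha
        (f := fun Y => max (‖X‖ + 1 - ‖Y‖) 0 * f Y ^ 2) ((hcut.comp continuous_norm).mul (hf.pow 2)) hcs.mul_right)]
    at hzero
  have hae : f =ᵐ[volume.restrict (Metric.ball 0 (‖X‖ + 1))] fun _ => 0 := by
    rw [Filter.EventuallyEq, ae_restrict_iff' Metric.isOpen_ball.measurableSet]
    filter_upwards [hzero, ae_weight_ne_zero n a] with Y hY hw hball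
    have hlt : ‖Y‖ < ‖X‖ + 1 := by simpa using hball
    have hm : max (‖X‖ + 1 - ‖Y‖) 0 ≠ 0 := (lt_max_of_lt_left (by linarith)).ne'
    simpa [hw, hm] using hY
  exact Measure.eqOn_open_of_ae_eq hae Metric.isOpen_ball hf.continuousOn continuousOn_const
    (by simp)

end Frequency

/-- If `p` is smooth, `L_a`-harmonic (weakly) on `ℝ^{n+1}`, with
`H(r) > 0` and constant Almgren frequency `N(r) = E(r)/H(r) = k` on `(0,∞)`,
then `p` is homogeneous of degree `k`. -/
theorem constant_frequency_implies_homogeneous (n : ℕ) (a k : ℝ)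
    (ha : a ∈ Set.Ioo (-1 : ℝ) 1)
    (p : EuclideanSpace ℝ (Fin (n + 1)) → ℝ) (hp : ContDiff ℝ (⊤ : ℕ∞) p)
    (hharm : ∀ φ : EuclideanSpace ℝ (Fin (n + 1)) → ℝ,
      ContDiff ℝ (⊤ : ℕ∞) φ → HasCompactSupport φ →
      ∫ X, |X (Fin.last n)| ^ a * ⟪gradient p X, gradient φ X⟫ = 0)
    (hH : ∀ r : ℝ, 0 < r →
      0 < r ^ (-((n : ℝ) + a)) *
        sphInt n (fun X => |X (Fin.last n)| ^ a * p X ^ 2) 0 r)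
    (hN : ∀ r : ℝ, 0 < r →
      r ^ (-((n : ℝ) + a - 1)) *
          ∫ X in Metric.ball (0 : EuclideanSpace ℝ (Fin (n + 1))) r,
            |X (Fin.last n)| ^ a * ‖gradient p X‖ ^ 2
        = k * (r ^ (-((n : ℝ) + a)) *
            sphInt n (fun X => |X (Fin.last n)| ^ a * p X ^ 2) 0 r)) :
    ∀ lam : ℝ, 0 < lam → ∀ X : EuclideanSpace ℝ (Fin (n + 1)),
      p (lam • X) = lam ^ k * p X := by
  have ha1 : -1 < a := ha.1
  have hu : IsWeightedHarmonic n a p := ⟨hp, hharm⟩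
  have hmean : ∀ r : ℝ, 0 < r → r ^ (-((n : ℝ) + a)) *
      sphInt n (fun X => |X (Fin.last n)| ^ a * p X ^ 2) 0 r =
        ∫ ω : Metric.sphere (0 : EuclideanSpace ℝ (Fin (n + 1))) 1,
          p (r • (ω : EuclideanSpace ℝ (Fin (n + 1)))) ^ 2 ∂(weightedSphereMeasure n a) := by
    intro r hr
    have hw := fun X => weight_smul n a hr X
    simp only [weight] at hw
    simp only [sphInt, zero_add, hw, mul_assoc]
    rw [integral_const_mul, integral_weightedSphereMeasure, Real.rpow_neg hr.le,
      Real.rpow_add hr, Real.rpow_natCast]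
    have h1 : r ^ n ≠ 0 := (pow_pos hr n).ne'
    have h2 : r ^ a ≠ 0 := (Real.rpow_pos_of_pos hr a).ne'
    simp only [weight]
    field_simp
  have henergy := fun r hr => hu.integral_sphere_mul_eulerDeriv (k := k) ha1 (fun r hr => by
    have h := hN r hr
    rw [hmean r hr, Real.rpow_neg hr.le] at h
    exact (inv_mul_eq_iff_eq_mul₀ (Real.rpow_pos_of_pos hr _).ne').1 h) (r := r) hr
  have hdiag := spherePairing_diag (k := k) ha1 hp fun τ => by
    simpa only [spherePairing, sq] using henergy (Real.exp τ) (Real.exp_pos τ)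
  intro lam hlam X
  have hcont : Continuous fun X => p (lam • X) - lam ^ k * p X := by
    have := hp.continuous
    fun_prop
  refine sub_eq_zero.1 (eq_zero_of_integral_sphere_sq_eq_zero ha1 hcont (fun r hr => ?_) X)
  have h := hu.integral_sq_sub_eq_zero ha1 hdiag (Real.log lam) (Real.log r)
  rw [Real.exp_add, mul_comm k, ← Real.rpow_def_of_pos hlam, Real.exp_log hlam,
    Real.exp_log hr] at h
  simpa only [smul_smul] using h
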